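/- Let k be an algebraically closed field and Q a finite quiver with vertex set {1, …, m}. If d ∈ ℕ^m is a positive dimension vector with q_Q(d) ≤ 0, then the set of G(d)-orbits on 𝔸_Q(d) is infinite. -/

import Mathlib

open scoped Matrix

/-- The representation space `𝔸_Q(d)` of a quiver with vertex set `Fin m`, arrow set `E` and
source/target maps `src, tgt`, for the dimension vector `d`. -/
def RepSpace (k : Type) [Field k] {m : ℕ} {E : Type} (src tgt : E → Fin m)
    (d : Fin m → ℕ) : Type :=
  ∀ a : E, Matrix (Fin (d (tgt a))) (Fin (d (src a))) k

/-- Two points of `𝔸_Q(d)` lie in the same `G(d)`-orbit, where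
`G(d) = ∏ᵢ GL_{dᵢ}(k)` acts by `(g · x)_α = g_{tgt α} x_α g_{src α}⁻¹`. -/
def RepOrbitRel (k : Type) [Field k] {m : ℕ} {E : Type} (src tgt : E → Fin m)
    (d : Fin m → ℕ) (x y : RepSpace k src tgt d) : Prop :=
  ∃ g : ∀ i : Fin m, Matrix.GeneralLinearGroup (Fin (d i)) k,
    ∀ a : E, y a = ((g (tgt a) : Matrix (Fin (d (tgt a))) (Fin (d (tgt a))) k) * x a) *
      (((g (src a))⁻¹ : Matrix.GeneralLinearGroup (Fin (d (src a))) k) :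
        Matrix (Fin (d (src a))) (Fin (d (src a))) k)

/-- The Tits form `q_Q(x) = Σᵢ xᵢ² − Σ_{α : i → j} xᵢ xⱼ` of the quiver. -/
def TitsForm {m : ℕ} {E : Type} [Fintype E] (src tgt : E → Fin m) (x : Fin m → ℤ) : ℤ :=
  ∑ i : Fin m, x i ^ 2 - ∑ a : E, x (src a) * x (tgt a)

/-- Any family of more than `n` elements in a localization `k[t₁, …, tₙ]_Δ` satisfies a
nontrivial polynomial relation. -/
theorem exists_aeval_eq_zero_of_card_lt {k τ ι : Type} [Field k] [Fintype τ] [Fintype ι]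
    {Δ : MvPolynomial τ k} (hΔ : Δ ≠ 0) (hcard : Fintype.card τ < Fintype.card ι)
    (f : ι → Localization.Away Δ) :
    ∃ P : MvPolynomial ι k, P ≠ 0 ∧ MvPolynomial.aeval f P = 0 := by
  have hle : Submonoid.powers Δ ≤ nonZeroDivisors (MvPolynomial τ k) :=
    powers_le_nonZeroDivisors_of_noZeroDivisors hΔ
  have : IsDomain (Localization.Away Δ) := IsLocalization.isDomain_localization hle
  have : FaithfulSMul (MvPolynomial τ k) (Localization.Away Δ) :=
    (faithfulSMul_iff_algebraMap_injective _ _).2 (IsLocalization.injective _ hle)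
  have : Algebra.IsAlgebraic (MvPolynomial τ k) (Localization.Away Δ) :=
    IsLocalization.isAlgebraic _ (Submonoid.powers Δ)
  have htr : Algebra.trdeg k (Localization.Away Δ) = Fintype.card τ := by
    rw [← trdeg_add_eq k (MvPolynomial τ k) (A := Localization.Away Δ),
      MvPolynomial.trdeg_of_isDomain, trdeg_eq_zero]
    simp
  have hdep : ¬ AlgebraicIndependent k f := fun h => by
    have := h.cardinalMk_le_trdeg
    rw [htr, Cardinal.mk_fintype, Nat.cast_le] at this
    omega
  rw [algebraicIndependent_iff] at hdep
  push Not at hdep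
  obtain ⟨P, h0, hP⟩ := hdep
  exact ⟨P, hP, h0⟩

section RepSpace

variable {k : Type} [Field k] {m : ℕ} {E : Type} {src tgt : E → Fin m} {d : Fin m → ℕ}

theorem repOrbitRel_equivalence : Equivalence (RepOrbitRel k src tgt d) where
  refl x := ⟨1, fun a => by simp⟩
  symm := by
    rintro x y ⟨g, hg⟩
    refine ⟨fun i => (g i)⁻¹, fun a => ?_⟩
    rw [hg a, inv_inv]
    simp only [Matrix.mul_assoc, Units.inv_mul, Matrix.mul_one]
    rw [← Matrix.mul_assoc, Units.inv_mul, Matrix.one_mul]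
  trans := by
    rintro x y z ⟨g, hg⟩ ⟨h, hh⟩
    refine ⟨fun i => h i * g i, fun a => ?_⟩
    rw [hh a, hg a, mul_inv_rev, Units.val_mul, Units.val_mul]
    simp only [Matrix.mul_assoc]

/-- The coordinates of a point of the representation space. -/
def repCoord (y : RepSpace k src tgt d)
    (c : Σ a : E, Fin (d (tgt a)) × Fin (d (src a))) : k :=
  y c.1 c.2.1 c.2.2

/-- Every orbit relation between `x` and `y` can be realized by a group element having entry `1`
at some position, since the scalars act trivially. -/
theorem RepOrbitRel.exists_normalized {x y : RepSpace k src tgt d} (h : RepOrbitRel k src tgt d x y)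
    (hd : d ≠ 0) :
    ∃ (s : Σ i : Fin m, Fin (d i) × Fin (d i))
      (g : ∀ i : Fin m, Matrix (Fin (d i)) (Fin (d i)) k),
      (∀ i, (g i).det ≠ 0) ∧ g s.1 s.2.1 s.2.2 = 1 ∧
        ∀ a, y a = g (tgt a) * x a * (g (src a))⁻¹ := by
  obtain ⟨g, hg⟩ := h
  obtain ⟨i, hi⟩ := Function.ne_iff.1 hd
  have : Nonempty (Fin (d i)) := ⟨⟨0, Nat.pos_of_ne_zero hi⟩⟩
  have hne : (g i : Matrix (Fin (d i)) (Fin (d i)) k) ≠ 0 := (g i).ne_zero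
  obtain ⟨p, q, hpq⟩ : ∃ p q, (g i : Matrix (Fin (d i)) (Fin (d i)) k) p q ≠ 0 := by
    by_contra! h
    exact hne (Matrix.ext h)
  set c := (g i : Matrix (Fin (d i)) (Fin (d i)) k) p q with hc
  have hdet : ∀ j, IsUnit (g j : Matrix (Fin (d j)) (Fin (d j)) k).det := fun j =>
    (Matrix.isUnit_iff_isUnit_det _).1 (g j).isUnit
  refine ⟨⟨i, p, q⟩, fun j => c⁻¹ • (g j : Matrix (Fin (d j)) (Fin (d j)) k), fun j => ?_, ?_,
    fun a => ?_⟩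
  · rw [Matrix.det_smul]
    exact mul_ne_zero (pow_ne_zero _ (inv_ne_zero hpq)) (hdet j).ne_zero
  · simp [← hc, hpq]
  · have hinv : (c⁻¹ • (g (src a) : Matrix (Fin (d (src a))) (Fin (d (src a))) k))⁻¹ =
        c • (g (src a) : Matrix (Fin (d (src a))) (Fin (d (src a))) k)⁻¹ := by
      refine Matrix.inv_eq_right_inv ?_
      rw [Matrix.smul_mul, Matrix.mul_smul, smul_smul, inv_mul_cancel₀ hpq, one_smul,
        Matrix.mul_nonsing_inv _ (hdet _)]
    rw [hinv, hg a, Matrix.coe_units_inv, Matrix.smul_mul, Matrix.mul_smul, Matrix.smul_mul,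
      smul_smul, mul_inv_cancel₀ hpq, one_smul]

/-- The part of an orbit reached by group elements with entry `1` at a fixed position lies in a
hypersurface. -/
theorem exists_hypersurface_of_titsForm_nonpos [Fintype E]
    (hq : TitsForm src tgt (fun i => (d i : ℤ)) ≤ 0) (x : RepSpace k src tgt d)
    (s : Σ i : Fin m, Fin (d i) × Fin (d i)) :
    ∃ P : MvPolynomial (Σ a : E, Fin (d (tgt a)) × Fin (d (src a))) k, P ≠ 0 ∧
      ∀ (y : RepSpace k src tgt d) (g : ∀ i : Fin m, Matrix (Fin (d i)) (Fin (d i)) k),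
        (∀ i, (g i).det ≠ 0) → g s.1 s.2.1 s.2.2 = 1 →
        (∀ a, y a = g (tgt a) * x a * (g (src a))⁻¹) →
        MvPolynomial.eval (repCoord y) P = 0 := by
  classical
  let τ := {t : Σ i : Fin m, Fin (d i) × Fin (d i) // t ≠ s}
  let X : ∀ i : Fin m, Matrix (Fin (d i)) (Fin (d i)) (MvPolynomial τ k) := fun i p q =>
    if h : (⟨i, p, q⟩ : Σ i : Fin m, Fin (d i) × Fin (d i)) ≠ s then MvPolynomial.X ⟨_, h⟩ else 1
  let Δ : MvPolynomial τ k := ∏ i, (X i).det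
  let pt (g : ∀ i : Fin m, Matrix (Fin (d i)) (Fin (d i)) k) : τ → k :=
    fun t => g t.1.1 t.1.2.1 t.1.2.2
  have hX : ∀ g : ∀ i : Fin m, Matrix (Fin (d i)) (Fin (d i)) k, g s.1 s.2.1 s.2.2 = 1 →
      ∀ i, (X i).map (MvPolynomial.aeval (pt g)) = g i := by
    intro g hg i
    ext p q
    rw [Matrix.map_apply]
    dsimp only [X]
    by_cases h : (⟨i, p, q⟩ : Σ i : Fin m, Fin (d i) × Fin (d i)) = s
    · subst h
      rw [dif_neg (not_not.2 rfl), map_one, hg]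
    · rw [dif_pos h, MvPolynomial.aeval_X]
  have hΔ : ∀ g : ∀ i : Fin m, Matrix (Fin (d i)) (Fin (d i)) k, g s.1 s.2.1 s.2.2 = 1 →
      MvPolynomial.aeval (pt g) Δ = ∏ i, (g i).det := by
    intro g hg
    rw [map_prod]
    refine Finset.prod_congr rfl fun i _ => ?_
    rw [AlgHom.map_det, AlgHom.mapMatrix_apply, hX g hg i]
  by_cases hΔ0 : Δ = 0
  · refine ⟨1, one_ne_zero, fun y g hdet hg _ => ?_⟩
    have h := hΔ g hg
    rw [hΔ0, map_zero] at h
    exact absurd h.symm (Finset.prod_ne_zero_iff.2 fun i _ => hdet i)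
  let L := Localization.Away Δ
  let XL : ∀ i : Fin m, Matrix (Fin (d i)) (Fin (d i)) L := fun i =>
    (X i).map (algebraMap (MvPolynomial τ k) L)
  let F : (Σ a : E, Fin (d (tgt a)) × Fin (d (src a))) → L := fun c =>
    (XL (tgt c.1) * (x c.1).map (algebraMap k L) * (XL (src c.1))⁻¹) c.2.1 c.2.2
  have hunit : ∀ i, IsUnit (XL i).det := fun i => by
    have : (XL i).det = algebraMap (MvPolynomial τ k) L (X i).det := by
      rw [RingHom.map_det, RingHom.mapMatrix_apply]
    rw [this]
    exact isUnit_of_dvd_unit (map_dvd _ (Finset.dvd_prod_of_mem (fun i => (X i).det) (Finset.mem_univ i)))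
      (IsLocalization.Away.algebraMap_isUnit Δ)
  have hcard : Fintype.card τ < Fintype.card (Σ a : E, Fin (d (tgt a)) × Fin (d (src a))) := by
    have h1 : Fintype.card τ < Fintype.card (Σ i : Fin m, Fin (d i) × Fin (d i)) :=
      Fintype.card_subtype_lt (x := s) (by simp)
    refine h1.trans_le ?_
    simp only [Fintype.card_sigma, Fintype.card_prod, Fintype.card_fin]
    rw [TitsForm] at hq
    zify
    simp only [pow_two] at hq
    simp only [mul_comm (d (tgt _) : ℤ)]
    linarith
  obtain ⟨P, hP, hPF⟩ := exists_aeval_eq_zero_of_card_lt hΔ0 hcard F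
  refine ⟨P, hP, fun y g hdet hg hy => ?_⟩
  have hu : IsUnit ((MvPolynomial.aeval (pt g) : MvPolynomial τ k →ₐ[k] k).toRingHom Δ) := by
    refine IsUnit.mk0 _ ?_
    change MvPolynomial.aeval (pt g) Δ ≠ 0
    rw [hΔ g hg]
    exact Finset.prod_ne_zero_iff.2 fun i _ => hdet i
  let φ : L →+* k := IsLocalization.Away.lift Δ hu
  have hφ : ∀ r, φ (algebraMap (MvPolynomial τ k) L r) = MvPolynomial.aeval (pt g) r := fun r =>
    IsLocalization.Away.lift_eq Δ hu r
  have hφk : ∀ r : k, φ (algebraMap k L r) = r := fun r => by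
    rw [IsScalarTower.algebraMap_apply k (MvPolynomial τ k) L, hφ]
    simp
  have hφX : ∀ i, (XL i).map φ = g i := fun i => by
    rw [← hX g hg i]
    ext p q
    exact hφ _
  have hφinv : ∀ i, ((XL i)⁻¹).map φ = (g i)⁻¹ := fun i => by
    refine (Matrix.inv_eq_right_inv ?_).symm
    rw [← hφX i, ← Matrix.map_mul, Matrix.mul_nonsing_inv _ (hunit i)]
    exact Matrix.map_one _ (map_zero φ) (map_one φ)
  have hF : ∀ c, φ (F c) = repCoord y c := fun c => by
    have hxk : ((x c.1).map (algebraMap k L)).map φ = x c.1 := by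
      ext p q
      exact hφk _
    have : (XL (tgt c.1) * (x c.1).map (algebraMap k L) * (XL (src c.1))⁻¹).map φ = y c.1 := by
      rw [Matrix.map_mul, Matrix.map_mul, hφX, hφinv, hxk, hy]
    exact congrFun (congrFun this c.2.1) c.2.2
  have hcomp : φ.comp (algebraMap k L) = RingHom.id k := RingHom.ext hφk
  have := congrArg φ hPF
  rw [map_zero, MvPolynomial.aeval_def, MvPolynomial.hom_eval₂, hcomp] at this
  rw [← this, MvPolynomial.eval, MvPolynomial.coe_eval₂Hom]
  congr 1
  exact funext fun c => (hF c).symm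

end RepSpace

/-- over an algebraically closed field `k`, if `d` is a positive dimension vector
of a finite quiver `Q` with `q_Q(d) ≤ 0`, then the set of `G(d)`-orbits on `𝔸_Q(d)` is
infinite. -/
theorem infinite_orbits_of_titsForm_nonpos (k : Type) [Field k] [IsAlgClosed k]
    {m : ℕ} {E : Type} [Fintype E] (src tgt : E → Fin m) (d : Fin m → ℕ)
    (hpos : d ≠ 0)
    (hq : TitsForm src tgt (fun i => (d i : ℤ)) ≤ 0) :
    Infinite (Quot (RepOrbitRel k src tgt d)) := by
  refine not_finite_iff_infinite.1 fun hfin => ?_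
  have := Fintype.ofFinite (Quot (RepOrbitRel k src tgt d))
  choose P hP0 hP using exists_hypersurface_of_titsForm_nonpos (k := k) hq
  have hne : (∏ c : Quot (RepOrbitRel k src tgt d), ∏ s, P c.out s) ≠ 0 :=
    Finset.prod_ne_zero_iff.2 fun c _ => Finset.prod_ne_zero_iff.2 fun s _ => hP0 _ _
  refine hne (MvPolynomial.funext fun v => ?_)
  let y : RepSpace k src tgt d := fun a p q => v ⟨a, p, q⟩
  have hrel : RepOrbitRel k src tgt d (Quot.mk (RepOrbitRel k src tgt d) y).out y :=
    repOrbitRel_equivalence.eqvGen_iff.1 (Quot.eqvGen_exact (Quot.out_eq _))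
  obtain ⟨s, g, hdet, hg, hy⟩ := hrel.exists_normalized hpos
  rw [map_zero, map_prod]
  refine Finset.prod_eq_zero (Finset.mem_univ (Quot.mk _ y)) ?_
  rw [map_prod]
  exact Finset.prod_eq_zero (Finset.mem_univ s) (hP _ s y g hdet hg hy)
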